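/- Assume the left Gorenstein global dimension of R is at most n for some non-negative integer n. If an R-module M has finite injective dimension, then pd_R(M) ≤ n, id_R(M) ≤ n, and fd_R(M) ≤ n. -/

import Mathlib

/-! Definitions for Gorenstein homological algebra over an arbitrary
associative ring `R` (left modules; right modules are `Rᵐᵒᵖ`-modules). -/

universe u

section Defs

variable (R : Type u) [Ring R]

/-- `0 → A → B → C → 0` is a short exact sequence. -/
def IsSES {A B C : Type u} [AddCommGroup A] [Module R A] [AddCommGroup B] [Module R B]
    [AddCommGroup C] [Module R C] (f : A →ₗ[R] B) (g : B →ₗ[R] C) : Prop :=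
  Function.Injective f ∧ Function.Exact f g ∧ Function.Surjective g

/-- `M` is Gorenstein projective: it is the kernel of a map in a doubly infinite exact
complex of projective modules which stays exact under `Hom_R(-, Q)` for every projective `Q`. -/
def GorensteinProjective (M : Type u) [AddCommGroup M] [Module R M] : Prop :=
  ∃ (P : ℤ → Type u) (_ : ∀ i, AddCommGroup (P i)) (_ : ∀ i, Module R (P i))
    (d : ∀ i, P i →ₗ[R] P (i + 1)),
      (∀ i, Module.Projective R (P i)) ∧
      (∀ i, Function.Exact (d i) (d (i + 1))) ∧
      Nonempty (M ≃ₗ[R] LinearMap.ker (d 0)) ∧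
      (∀ (Q : Type u) (_ : AddCommGroup Q) (_ : Module R Q), Module.Projective R Q →
        ∀ i, Function.Exact (fun g : P (i + 1 + 1) →ₗ[R] Q => g.comp (d (i + 1)))
          (fun g : P (i + 1) →ₗ[R] Q => g.comp (d i)))

/-- `M` is strongly Gorenstein projective: there is a complete projective resolution
with a single projective module `P` and a single map `f`. -/
def StronglyGorensteinProjective (M : Type u) [AddCommGroup M] [Module R M] : Prop :=
  ∃ (P : Type u) (_ : AddCommGroup P) (_ : Module R P) (f : P →ₗ[R] P),
    Module.Projective R P ∧
    Function.Exact f f ∧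
    Nonempty (M ≃ₗ[R] LinearMap.ker f) ∧
    (∀ (Q : Type u) (_ : AddCommGroup Q) (_ : Module R Q), Module.Projective R Q →
      Function.Exact (fun g : P →ₗ[R] Q => g.comp f) (fun g : P →ₗ[R] Q => g.comp f))

/-- `M` is Gorenstein injective (dual to Gorenstein projective). -/
def GorensteinInjective (M : Type u) [AddCommGroup M] [Module R M] : Prop :=
  ∃ (I : ℤ → Type u) (_ : ∀ i, AddCommGroup (I i)) (_ : ∀ i, Module R (I i))
    (d : ∀ i, I i →ₗ[R] I (i + 1)),
      (∀ i, Module.Injective R (I i)) ∧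
      (∀ i, Function.Exact (d i) (d (i + 1))) ∧
      Nonempty (M ≃ₗ[R] LinearMap.ker (d 0)) ∧
      (∀ (E : Type u) (_ : AddCommGroup E) (_ : Module R E), Module.Injective R E →
        ∀ i, Function.Exact (fun g : E →ₗ[R] I i => (d i).comp g)
          (fun g : E →ₗ[R] I (i + 1) => (d (i + 1)).comp g))

/-- `M` is strongly Gorenstein injective. -/
def StronglyGorensteinInjective (M : Type u) [AddCommGroup M] [Module R M] : Prop :=
  ∃ (I : Type u) (_ : AddCommGroup I) (_ : Module R I) (f : I →ₗ[R] I),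
    Module.Injective R I ∧
    Function.Exact f f ∧
    Nonempty (M ≃ₗ[R] LinearMap.ker f) ∧
    (∀ (E : Type u) (_ : AddCommGroup E) (_ : Module R E), Module.Injective R E →
      Function.Exact (fun g : E →ₗ[R] I => f.comp g) (fun g : E →ₗ[R] I => f.comp g))

/-- `M` admits a resolution `0 → G_n → ⋯ → G_0 → M → 0` by modules satisfying `𝒢`
(formalized as an `ℕ`-indexed resolution vanishing in degrees `> n`). -/
def HasLeftResolutionLE
    (𝒢 : ∀ (N : Type u) [AddCommGroup N] [Module R N], Prop)
    (M : Type u) [AddCommGroup M] [Module R M] (n : ℕ) : Prop :=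
  ∃ (G : ℕ → Type u) (_ : ∀ i, AddCommGroup (G i)) (_ : ∀ i, Module R (G i))
    (d : ∀ i, G (i + 1) →ₗ[R] G i) (π : G 0 →ₗ[R] M),
      (∀ i, 𝒢 (G i)) ∧
      (∀ i, n < i → Subsingleton (G i)) ∧
      Function.Surjective π ∧ Function.Exact (d 0) π ∧
      (∀ i, Function.Exact (d (i + 1)) (d i))

/-- `M` admits a coresolution `0 → M → G^0 → ⋯ → G^n → 0` by modules satisfying `𝒢`. -/
def HasRightResolutionLE
    (𝒢 : ∀ (N : Type u) [AddCommGroup N] [Module R N], Prop)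
    (M : Type u) [AddCommGroup M] [Module R M] (n : ℕ) : Prop :=
  ∃ (G : ℕ → Type u) (_ : ∀ i, AddCommGroup (G i)) (_ : ∀ i, Module R (G i))
    (d : ∀ i, G i →ₗ[R] G (i + 1)) (ι : M →ₗ[R] G 0),
      (∀ i, 𝒢 (G i)) ∧
      (∀ i, n < i → Subsingleton (G i)) ∧
      Function.Injective ι ∧ Function.Exact ι (d 0) ∧
      (∀ i, Function.Exact (d i) (d (i + 1)))

variable (M : Type u) [AddCommGroup M] [Module R M]

/-- Projective dimension, valued in `ℕ∞`. -/
noncomputable def pDim : ℕ∞ :=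
  sInf ((↑) '' {n : ℕ | HasLeftResolutionLE R (fun N _ _ => Module.Projective R N) M n})

/-- Injective dimension, valued in `ℕ∞`. -/
noncomputable def iDim : ℕ∞ :=
  sInf ((↑) '' {n : ℕ | HasRightResolutionLE R (fun N _ _ => Module.Injective R N) M n})

/-- Gorenstein projective dimension, valued in `ℕ∞`. -/
noncomputable def gpDim : ℕ∞ :=
  sInf ((↑) '' {n : ℕ | HasLeftResolutionLE R (fun N _ _ => GorensteinProjective R N) M n})

/-- Gorenstein injective dimension, valued in `ℕ∞`. -/
noncomputable def giDim : ℕ∞ :=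
  sInf ((↑) '' {n : ℕ | HasRightResolutionLE R (fun N _ _ => GorensteinInjective R N) M n})

/-- The left global dimension of `R`. -/
noncomputable def gldim : ℕ∞ :=
  sSup {d : ℕ∞ | ∃ (M : Type u) (_ : AddCommGroup M) (_ : Module R M), d = pDim R M}

/-- The left finitistic projective dimension of `R`. -/
noncomputable def FPD : ℕ∞ :=
  sSup {d : ℕ∞ | ∃ (M : Type u) (_ : AddCommGroup M) (_ : Module R M),
    pDim R M ≠ ⊤ ∧ d = pDim R M}

/-- The left Gorenstein global dimension of `R`: `sup { Gpd_R(M) }`. -/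
noncomputable def GPgldim : ℕ∞ :=
  sSup {d : ℕ∞ | ∃ (M : Type u) (_ : AddCommGroup M) (_ : Module R M), d = gpDim R M}

/-- `sup { Gid_R(M) }` over all left `R`-modules `M`. -/
noncomputable def GIgldim : ℕ∞ :=
  sSup {d : ℕ∞ | ∃ (M : Type u) (_ : AddCommGroup M) (_ : Module R M), d = giDim R M}

end Defs
section Tensor

open TensorProduct

variable (R : Type u) [Ring R]

/-- The defining relations of the tensor product `N ⊗_R M` of a right `R`-module `N`
and a left `R`-module `M`, inside the tensor product of abelian groups `N ⊗[ℤ] M`. -/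
noncomputable def tensorRel (N : Type u) [AddCommGroup N] [Module Rᵐᵒᵖ N]
    (M : Type u) [AddCommGroup M] [Module R M] : AddSubgroup (N ⊗[ℤ] M) :=
  AddSubgroup.closure {x | ∃ (r : R) (n : N) (m : M),
    x = (MulOpposite.op r • n) ⊗ₜ[ℤ] m - n ⊗ₜ[ℤ] (r • m)}

/-- The tensor product `N ⊗_R M` (an abelian group) of a right `R`-module `N` and a
left `R`-module `M` over the (possibly noncommutative) ring `R`. -/
abbrev bTensor (N : Type u) [AddCommGroup N] [Module Rᵐᵒᵖ N]
    (M : Type u) [AddCommGroup M] [Module R M] : Type u :=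
  (N ⊗[ℤ] M) ⧸ tensorRel R N M

/-- The map `N ⊗_R M →+ N ⊗_R M'` induced by a map `f : M →ₗ[R] M'` of left modules. -/
noncomputable def tmapRight (N : Type u) [AddCommGroup N] [Module Rᵐᵒᵖ N]
    {M M' : Type u} [AddCommGroup M] [Module R M] [AddCommGroup M'] [Module R M']
    (f : M →ₗ[R] M') : bTensor R N M →+ bTensor R N M' :=
  QuotientAddGroup.map _ _ (LinearMap.lTensor N (f.restrictScalars ℤ)).toAddMonoidHom <| by
    rw [tensorRel, AddSubgroup.closure_le]
    rintro x ⟨r, n, m, rfl⟩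
    simp only [AddSubgroup.coe_comap, Set.mem_preimage, LinearMap.toAddMonoidHom_coe,
      map_sub, LinearMap.lTensor_tmul, SetLike.mem_coe]
    refine AddSubgroup.subset_closure ⟨r, n, f m, ?_⟩
    simp [LinearMap.map_smul]

/-- The map `N ⊗_R M →+ N' ⊗_R M` induced by a map `g : N →ₗ[Rᵐᵒᵖ] N'` of right modules. -/
noncomputable def tmapLeft {N N' : Type u} [AddCommGroup N] [Module Rᵐᵒᵖ N]
    [AddCommGroup N'] [Module Rᵐᵒᵖ N']
    (M : Type u) [AddCommGroup M] [Module R M]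
    (g : N →ₗ[Rᵐᵒᵖ] N') : bTensor R N M →+ bTensor R N' M :=
  QuotientAddGroup.map _ _ (LinearMap.rTensor M (g.restrictScalars ℤ)).toAddMonoidHom <| by
    rw [tensorRel, AddSubgroup.closure_le]
    rintro x ⟨r, n, m, rfl⟩
    simp only [AddSubgroup.coe_comap, Set.mem_preimage, LinearMap.toAddMonoidHom_coe,
      map_sub, LinearMap.rTensor_tmul, SetLike.mem_coe]
    refine AddSubgroup.subset_closure ⟨r, g n, m, ?_⟩
    simp [LinearMap.map_smul]

/-- A left `R`-module `M` is flat if `- ⊗_R M` preserves injectivity of maps of right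
`R`-modules. -/
def ModFlat (M : Type u) [AddCommGroup M] [Module R M] : Prop :=
  ∀ (N N' : Type u) (_ : AddCommGroup N) (_ : Module Rᵐᵒᵖ N)
    (_ : AddCommGroup N') (_ : Module Rᵐᵒᵖ N') (g : N →ₗ[Rᵐᵒᵖ] N'),
      Function.Injective g → Function.Injective (tmapLeft R M g)

/-- `M` is Gorenstein flat: it is the kernel of a map in a doubly infinite exact complex
of flat modules which stays exact under `E ⊗_R -` for every injective right `R`-module `E`. -/
def GorensteinFlat (M : Type u) [AddCommGroup M] [Module R M] : Prop :=
  ∃ (F : ℤ → Type u) (_ : ∀ i, AddCommGroup (F i)) (_ : ∀ i, Module R (F i))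
    (d : ∀ i, F i →ₗ[R] F (i + 1)),
      (∀ i, ModFlat R (F i)) ∧
      (∀ i, Function.Exact (d i) (d (i + 1))) ∧
      Nonempty (M ≃ₗ[R] LinearMap.ker (d 0)) ∧
      (∀ (E : Type u) (_ : AddCommGroup E) (_ : Module Rᵐᵒᵖ E), Module.Injective Rᵐᵒᵖ E →
        ∀ i, Function.Exact (tmapRight R E (d i)) (tmapRight R E (d (i + 1))))

/-- Flat dimension, valued in `ℕ∞`. -/
noncomputable def fDim (M : Type u) [AddCommGroup M] [Module R M] : ℕ∞ :=
  sInf ((↑) '' {n : ℕ | HasLeftResolutionLE R (fun N _ _ => ModFlat R N) M n})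

/-- Gorenstein flat dimension, valued in `ℕ∞`. -/
noncomputable def gfDim (M : Type u) [AddCommGroup M] [Module R M] : ℕ∞ :=
  sInf ((↑) '' {n : ℕ | HasLeftResolutionLE R (fun N _ _ => GorensteinFlat R N) M n})

/-- The weak global dimension of `R`. -/
noncomputable def wgldim : ℕ∞ :=
  sSup {d : ℕ∞ | ∃ (M : Type u) (_ : AddCommGroup M) (_ : Module R M), d = fDim R M}

/-- The left weak Gorenstein global dimension of `R`: `sup { Gfd_R(M) }`. -/
noncomputable def GFgldim : ℕ∞ :=
  sSup {d : ℕ∞ | ∃ (M : Type u) (_ : AddCommGroup M) (_ : Module R M), d = gfDim R M}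

end Tensor

section Helpers

open CategoryTheory CategoryTheory.Abelian

variable {R : Type u} [Ring R]

/-- Vanishing of `Ext^k(X, Q)`. -/
def ExtVan (R : Type u) [Ring R] (k : ℕ) (X Q : Type u) [AddCommGroup X] [Module R X]
    [AddCommGroup Q] [Module R Q] : Prop :=
  let := HasExt.standard (ModuleCat.{u} R)
  ∀ e : Ext.{u+1} (ModuleCat.of R X) (ModuleCat.of R Q) k, e = 0

/-- Projective dimension less than `k`. -/
abbrev PDLT (R : Type u) [Ring R] (X : Type u) [AddCommGroup X] [Module R X] (k : ℕ) : Prop :=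
  HasProjectiveDimensionLT (ModuleCat.of R X) k

/-- Injective dimension less than `k`. -/
abbrev IDLT (R : Type u) [Ring R] (X : Type u) [AddCommGroup X] [Module R X] (k : ℕ) : Prop :=
  HasInjectiveDimensionLT (ModuleCat.of R X) k

section SES

variable {A B C : Type u} [AddCommGroup A] [Module R A] [AddCommGroup B] [Module R B]
    [AddCommGroup C] [Module R C] {f : A →ₗ[R] B} {g : B →ₗ[R] C}

theorem ses_zero (h : IsSES R f g) : ModuleCat.ofHom f ≫ ModuleCat.ofHom g = 0 := by
  ext x
  exact h.2.1.apply_apply_eq_zero x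

theorem ses_shortExact (h : IsSES R f g) :
    (ShortComplex.mk (ModuleCat.ofHom f) (ModuleCat.ofHom g) (ses_zero h)).ShortExact where
  exact := (ShortComplex.ShortExact.moduleCat_exact_iff_function_exact _).mpr h.2.1
  mono_f := (ModuleCat.mono_iff_injective _).mpr h.1
  epi_g := (ModuleCat.epi_iff_surjective _).mpr h.2.2

theorem ext_third (h : IsSES R f g) (Q : Type u) [AddCommGroup Q] [Module R Q] (k : ℕ)
    (hA : ExtVan R k A Q) (hB : ExtVan R (k + 1) B Q) : ExtVan R (k + 1) C Q := by
  let := HasExt.standard (ModuleCat.{u} R)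
  intro e
  obtain ⟨x, rfl⟩ := Ext.contravariant_sequence_exact₃ (ses_shortExact h) _ e (hB _)
    (add_comm 1 k)
  have : x = 0 := hA x
  rw [this, Ext.comp_zero]

theorem ext_middle (h : IsSES R f g) (Q : Type u) [AddCommGroup Q] [Module R Q] (k : ℕ)
    (hA : ExtVan R k A Q) (hC : ExtVan R k C Q) : ExtVan R k B Q := by
  let := HasExt.standard (ModuleCat.{u} R)
  intro e
  obtain ⟨x, rfl⟩ := Ext.contravariant_sequence_exact₂ (ses_shortExact h) _ e (hA _)
  have : x = 0 := hC x
  rw [this, Ext.comp_zero]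

theorem ext_extend (h : IsSES R f g) (Q : Type u) [AddCommGroup Q] [Module R Q]
    (hC : ExtVan R 1 C Q) (φ : A →ₗ[R] Q) : ∃ ψ : B →ₗ[R] Q, ψ ∘ₗ f = φ := by
  let := HasExt.standard (ModuleCat.{u} R)
  obtain ⟨x, hx⟩ := Ext.contravariant_sequence_exact₁ (ses_shortExact h) _
    (Ext.mk₀ (ModuleCat.ofHom φ)) (add_zero 1) (hC _)
  obtain ⟨ψ, rfl⟩ := Ext.homEquiv₀.symm.surjective x
  refine ⟨ψ.hom, ?_⟩
  simp only [Ext.homEquiv₀_symm_apply, Ext.mk₀_comp_mk₀] at hx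
  have := Ext.homEquiv₀.symm.injective hx
  exact congrArg ModuleCat.Hom.hom this

theorem ext_proj (P Q : Type u) [AddCommGroup P] [Module R P] [AddCommGroup Q] [Module R Q]
    [Module.Projective R P] (k : ℕ) : ExtVan R (k + 1) P Q := by
  let := HasExt.standard (ModuleCat.{u} R)
  intro e
  have : Projective (ModuleCat.of R P) := (IsProjective.iff_projective P).mp inferInstance
  exact e.eq_zero_of_hasProjectiveDimensionLT 1 (by omega)

theorem ext_one_of_extend (h : IsSES R f g) (Q : Type u) [AddCommGroup Q] [Module R Q]
    [Module.Projective R B]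
    (hE : ∀ φ : A →ₗ[R] Q, ∃ ψ : B →ₗ[R] Q, ψ ∘ₗ f = φ) : ExtVan R 1 C Q := by
  let := HasExt.standard (ModuleCat.{u} R)
  intro e
  obtain ⟨x, rfl⟩ := Ext.contravariant_sequence_exact₃ (ses_shortExact h) _ e
    (ext_proj (R := R) B Q 0 _) (add_zero 1)
  obtain ⟨φ, rfl⟩ := Ext.homEquiv₀.symm.surjective x
  obtain ⟨ψ, hψ⟩ := hE φ.hom
  have : φ = ModuleCat.ofHom f ≫ ModuleCat.ofHom ψ := by
    ext x
    exact (LinearMap.congr_fun hψ x).symm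
  rw [this, Ext.homEquiv₀_symm_apply, ← Ext.mk₀_comp_mk₀]
  exact (ses_shortExact h).extClass_comp_assoc _

theorem ext_congr (e : A ≃ₗ[R] B) (Q : Type u) [AddCommGroup Q] [Module R Q] (k : ℕ)
    (h : ExtVan R k A Q) : ExtVan R k B Q := by
  have hs : IsSES R e.toLinearMap (0 : B →ₗ[R] PUnit.{u+1}) :=
    ⟨e.injective, fun y => by simpa using e.surjective y, fun y => ⟨0, rfl⟩⟩
  refine ext_middle hs Q k h ?_
  let := HasExt.standard (ModuleCat.{u} R)
  intro x
  have : HasProjectiveDimensionLT (ModuleCat.of R PUnit.{u+1}) 0 :=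
    (ModuleCat.isZero_of_subsingleton _).hasProjectiveDimensionLT_zero
  exact x.eq_zero_of_hasProjectiveDimensionLT 0 (by omega)

theorem pd_third (h : IsSES R f g) {k : ℕ} (hA : PDLT R A k) (hB : PDLT R B (k + 1)) :
    PDLT R C (k + 1) :=
  (ses_shortExact h).hasProjectiveDimensionLT_X₃ k hA hB

theorem pd_first (h : IsSES R f g) {k : ℕ} (hB : PDLT R B k) (hC : PDLT R C (k + 1)) :
    PDLT R A k :=
  (ses_shortExact h).hasProjectiveDimensionLT_X₁ k hB hC

theorem id_third (h : IsSES R f g) {k : ℕ} (hB : IDLT R B k) (hA : IDLT R A (k + 1)) :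
    IDLT R C k :=
  (ses_shortExact h).hasInjectiveDimensionLT_X₃ k hB hA

end SES

theorem pd_one_iff (P : Type u) [AddCommGroup P] [Module R P] :
    PDLT R P 1 ↔ Module.Projective R P := by
  rw [IsProjective.iff_projective P, projective_iff_hasProjectiveDimensionLT_one]

theorem id_one_iff (P : Type u) [AddCommGroup P] [Module R P] :
    IDLT R P 1 ↔ Module.Injective R P := by
  rw [Module.injective_iff_injective_object R P, injective_iff_hasInjectiveDimensionLT_one]

theorem pd_of_retract {X Y : Type u} [AddCommGroup X] [Module R X] [AddCommGroup Y] [Module R Y]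
    (i : X →ₗ[R] Y) (r : Y →ₗ[R] X) (h : r ∘ₗ i = LinearMap.id) {k : ℕ} (hY : PDLT R Y k) :
    PDLT R X k := by
  let ret : Retract (ModuleCat.of R X) (ModuleCat.of R Y) :=
    { i := ModuleCat.ofHom i
      r := ModuleCat.ofHom r
      retract := by ext x; exact LinearMap.congr_fun h x }
  exact ret.hasProjectiveDimensionLT k

theorem pd_mono {X : Type u} [AddCommGroup X] [Module R X] {k l : ℕ} (hkl : k ≤ l)
    (hX : PDLT R X k) : PDLT R X l :=
  hasProjectiveDimensionLT_of_ge _ k l hkl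

theorem id_mono {X : Type u} [AddCommGroup X] [Module R X] {k l : ℕ} (hkl : k ≤ l)
    (hX : IDLT R X k) : IDLT R X l :=
  hasInjectiveDimensionLT_of_ge _ k l hkl

theorem exists_inj_embedding (X : Type u) [AddCommGroup X] [Module R X] :
    ∃ (I : Type u) (_ : AddCommGroup I) (_ : Module R I) (C : Type u) (_ : AddCommGroup C)
      (_ : Module R C) (f : X →ₗ[R] I) (g : I →ₗ[R] C), Module.Injective R I ∧ IsSES R f g := by
  let J := Injective.under (ModuleCat.of R X)
  let i : ModuleCat.of R X ⟶ J := Injective.ι _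
  have hi : Function.Injective i.hom := (ModuleCat.mono_iff_injective i).mp inferInstance
  refine ⟨J, inferInstance, inferInstance, J ⧸ LinearMap.range i.hom, inferInstance,
    inferInstance, i.hom, Submodule.mkQ _, ?_, hi, ?_, Submodule.mkQ_surjective _⟩
  · exact (Module.injective_iff_injective_object R J).mpr (inferInstanceAs (Injective J))
  · exact LinearMap.exact_map_mkQ_range _

theorem exists_proj_cover (X : Type u) [AddCommGroup X] [Module R X] :
    ∃ (K : Type u) (_ : AddCommGroup K) (_ : Module R K) (P : Type u) (_ : AddCommGroup P)
      (_ : Module R P) (f : K →ₗ[R] P) (g : P →ₗ[R] X), Module.Projective R P ∧ IsSES R f g := by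
  let π : (X →₀ R) →ₗ[R] X := Finsupp.linearCombination R id
  refine ⟨LinearMap.ker π, inferInstance, inferInstance, X →₀ R, inferInstance, inferInstance,
    (LinearMap.ker π).subtype, π, inferInstance, Subtype.val_injective,
    LinearMap.exact_subtype_ker_map π, Finsupp.linearCombination_id_surjective R X⟩

section Diagram

/-- Pushout of two monomorphisms. -/
theorem pushout_mono {K G H M C : Type u} [AddCommGroup K] [Module R K] [AddCommGroup G]
    [Module R G] [AddCommGroup H] [Module R H] [AddCommGroup M] [Module R M]
    [AddCommGroup C] [Module R C] {i : K →ₗ[R] G} {π : G →ₗ[R] M} {j : K →ₗ[R] H}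
    {ρ : H →ₗ[R] C} (h₁ : IsSES R i π) (h₂ : IsSES R j ρ) :
    ∃ (X : Type u) (_ : AddCommGroup X) (_ : Module R X) (a : G →ₗ[R] X) (q : X →ₗ[R] C)
      (b : H →ₗ[R] X) (p : X →ₗ[R] M), IsSES R a q ∧ IsSES R b p := by
  let S : Submodule R (G × H) := LinearMap.range (i.prod (-j))
  have hS : ∀ x : G × H, x ∈ S ↔ ∃ k, i k = x.1 ∧ -j k = x.2 := fun x => by
    simp [S, LinearMap.mem_range, Prod.ext_iff]
  have hq : S ≤ LinearMap.ker (ρ ∘ₗ LinearMap.snd R G H) := by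
    intro x hx
    obtain ⟨k, _, h⟩ := (hS x).mp hx
    simp [← h, h₂.2.1.apply_apply_eq_zero]
  have hp : S ≤ LinearMap.ker (π ∘ₗ LinearMap.fst R G H) := by
    intro x hx
    obtain ⟨k, h, _⟩ := (hS x).mp hx
    simp [← h, h₁.2.1.apply_apply_eq_zero]
  refine ⟨(G × H) ⧸ S, inferInstance, inferInstance, S.mkQ ∘ₗ LinearMap.inl R G H,
    S.liftQ _ hq, S.mkQ ∘ₗ LinearMap.inr R G H, S.liftQ _ hp, ⟨?_, ?_, ?_⟩, ⟨?_, ?_, ?_⟩⟩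
  · refine (injective_iff_map_eq_zero _).mpr fun x hx => ?_
    have hx' : ((x, 0) : G × H) ∈ S := by simpa using hx
    obtain ⟨k, h, h'⟩ := (hS _).mp hx'
    have : k = 0 := h₂.1 (by simpa using h')
    simpa [this] using h.symm
  · intro y
    obtain ⟨⟨x, z⟩, rfl⟩ := S.mkQ_surjective y
    constructor
    · intro hy
      obtain ⟨k, rfl⟩ := (h₂.2.1 z).mp (by simpa using hy)
      refine ⟨x + i k, ?_⟩
      refine (Submodule.Quotient.eq S).mpr ((hS _).mpr ⟨k, ?_, ?_⟩) <;> simp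
    · rintro ⟨x', hx'⟩
      rw [← hx']
      simp
  · intro c
    obtain ⟨z, rfl⟩ := h₂.2.2 c
    exact ⟨S.mkQ (0, z), by simp⟩
  · refine (injective_iff_map_eq_zero _).mpr fun x hx => ?_
    have hx' : ((0, x) : G × H) ∈ S := by simpa using hx
    obtain ⟨k, h, h'⟩ := (hS _).mp hx'
    have : k = 0 := h₁.1 (by simpa using h)
    simpa [this] using h'.symm
  · intro y
    obtain ⟨⟨x, z⟩, rfl⟩ := S.mkQ_surjective y
    constructor
    · intro hy
      obtain ⟨k, rfl⟩ := (h₁.2.1 x).mp (by simpa using hy)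
      refine ⟨z + j k, ?_⟩
      refine (Submodule.Quotient.eq S).mpr ((hS _).mpr ⟨-k, ?_, ?_⟩) <;> simp
    · rintro ⟨x', hx'⟩
      rw [← hx']
      simp
  · intro c
    obtain ⟨z, rfl⟩ := h₁.2.2 c
    exact ⟨S.mkQ (z, 0), by simp⟩

theorem third_iso {H X M P X' : Type u} [AddCommGroup H] [Module R H] [AddCommGroup X]
    [Module R X] [AddCommGroup M] [Module R M] [AddCommGroup P] [Module R P]
    [AddCommGroup X'] [Module R X'] {b : H →ₗ[R] X} {p : X →ₗ[R] M} {j : X →ₗ[R] P}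
    {ρ : P →ₗ[R] X'} (h₁ : IsSES R b p) (h₂ : IsSES R j ρ) :
    ∃ (H' : Type u) (_ : AddCommGroup H') (_ : Module R H') (c : P →ₗ[R] H')
      (m : M →ₗ[R] H') (q : H' →ₗ[R] X'), IsSES R (j ∘ₗ b) c ∧ IsSES R m q := by
  let S : Submodule R P := LinearMap.range (j ∘ₗ b)
  have hq : S ≤ LinearMap.ker ρ := by
    rintro x ⟨k, rfl⟩
    simp [h₂.2.1.apply_apply_eq_zero]
  have hm : LinearMap.ker p ≤ LinearMap.ker (S.mkQ ∘ₗ j) := by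
    intro x hx
    obtain ⟨k, rfl⟩ := (h₁.2.1 x).mp hx
    exact (Submodule.Quotient.mk_eq_zero S).mpr ⟨k, rfl⟩
  let e := p.quotKerEquivOfSurjective h₁.2.2
  let m : M →ₗ[R] P ⧸ S := (LinearMap.ker p).liftQ _ hm ∘ₗ e.symm.toLinearMap
  have hmp : ∀ x, m (p x) = S.mkQ (j x) := by
    intro x
    have : e.symm (p x) = (LinearMap.ker p).mkQ x := by
      rw [LinearEquiv.symm_apply_eq]; rfl
    simp [m, this]
  refine ⟨P ⧸ S, inferInstance, inferInstance, S.mkQ, m, S.liftQ ρ hq,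
    ⟨h₂.1.comp h₁.1, LinearMap.exact_map_mkQ_range _, S.mkQ_surjective⟩, ⟨?_, ?_, ?_⟩⟩
  · refine (injective_iff_map_eq_zero _).mpr fun y hy => ?_
    obtain ⟨x, rfl⟩ := h₁.2.2 y
    rw [hmp] at hy
    obtain ⟨k, hk⟩ : j x ∈ S := by simpa using hy
    rw [← h₂.1 hk]
    exact h₁.2.1.apply_apply_eq_zero k
  · intro y
    obtain ⟨z, rfl⟩ := S.mkQ_surjective y
    constructor
    · intro hy
      obtain ⟨x, rfl⟩ := (h₂.2.1 z).mp (by simpa using hy)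
      exact ⟨p x, hmp x⟩
    · rintro ⟨y, hy⟩
      obtain ⟨x, rfl⟩ := h₁.2.2 y
      rw [← hy, hmp]
      simp [h₂.2.1.apply_apply_eq_zero]
  · intro c
    obtain ⟨z, rfl⟩ := h₂.2.2 c
    exact ⟨S.mkQ z, by simp⟩

theorem three_by_three {A X B P A' P' B' : Type u} [AddCommGroup A] [Module R A]
    [AddCommGroup X] [Module R X] [AddCommGroup B] [Module R B] [AddCommGroup P] [Module R P]
    [AddCommGroup A'] [Module R A'] [AddCommGroup P'] [Module R P'] [AddCommGroup B']
    [Module R B'] {a : A →ₗ[R] X} {b : X →ₗ[R] B} {i : A →ₗ[R] P} {q : P →ₗ[R] A'}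
    {i' : B →ₗ[R] P'} {q' : P' →ₗ[R] B'} (h : IsSES R a b) (h₁ : IsSES R i q)
    (h₂ : IsSES R i' q') (e : X →ₗ[R] P) (he : e ∘ₗ a = i) :
    ∃ (X' : Type u) (_ : AddCommGroup X') (_ : Module R X') (j : X →ₗ[R] P × P')
      (r : P × P' →ₗ[R] X') (s : A' →ₗ[R] X') (t : X' →ₗ[R] B'),
      IsSES R j r ∧ IsSES R s t := by
  have he' : ∀ x, e (a x) = i x := LinearMap.congr_fun he
  let j : X →ₗ[R] P × P' := e.prod (i' ∘ₗ b)
  let S : Submodule R (P × P') := LinearMap.range j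
  have hS : ∀ x : P × P', x ∈ S ↔ ∃ k, e k = x.1 ∧ i' (b k) = x.2 := fun x => by
    simp [S, j, LinearMap.mem_range, Prod.ext_iff]
  have hj : Function.Injective j := by
    refine (injective_iff_map_eq_zero _).mpr fun x hx => ?_
    have hx1 : e x = 0 := congrArg Prod.fst hx
    have hx2 : i' (b x) = 0 := congrArg Prod.snd hx
    have hb : b x = 0 := h₂.1 (by simpa using hx2)
    obtain ⟨α, rfl⟩ := (h.2.1 x).mp hb
    rw [he'] at hx1
    rw [h₁.1 (hx1.trans (map_zero i).symm), map_zero]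
  have ht : S ≤ LinearMap.ker (q' ∘ₗ LinearMap.snd R P P') := by
    intro x hx
    obtain ⟨k, _, h⟩ := (hS x).mp hx
    simp [← h, h₂.2.1.apply_apply_eq_zero]
  have hs : LinearMap.ker q ≤ LinearMap.ker (S.mkQ ∘ₗ LinearMap.inl R P P') := by
    intro x hx
    obtain ⟨k, rfl⟩ := (h₁.2.1 x).mp hx
    have : ((i k, 0) : P × P') ∈ S := (hS _).mpr ⟨a k, he' k, by
      simp [h.2.1.apply_apply_eq_zero]⟩
    simpa using this
  let ε := q.quotKerEquivOfSurjective h₁.2.2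
  let s : A' →ₗ[R] (P × P') ⧸ S := (LinearMap.ker q).liftQ _ hs ∘ₗ ε.symm.toLinearMap
  have hsq : ∀ x, s (q x) = S.mkQ (x, 0) := by
    intro x
    have : ε.symm (q x) = (LinearMap.ker q).mkQ x := by
      rw [LinearEquiv.symm_apply_eq]; rfl
    simp [s, this]
  refine ⟨(P × P') ⧸ S, inferInstance, inferInstance, j, S.mkQ, s, S.liftQ _ ht,
    ⟨hj, LinearMap.exact_map_mkQ_range _, S.mkQ_surjective⟩, ⟨?_, ?_, ?_⟩⟩
  · refine (injective_iff_map_eq_zero _).mpr fun y hy => ?_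
    obtain ⟨x, rfl⟩ := h₁.2.2 y
    rw [hsq] at hy
    have hx : ((x, 0) : P × P') ∈ S := by simpa using hy
    obtain ⟨k, hk, hk'⟩ := (hS _).mp hx
    have hb : b k = 0 := h₂.1 (by simpa using hk')
    obtain ⟨α, rfl⟩ := (h.2.1 k).mp hb
    have hk : i α = x := by rw [← he']; exact hk
    rw [← hk]
    exact h₁.2.1.apply_apply_eq_zero α
  · intro y
    obtain ⟨⟨x, z⟩, rfl⟩ := S.mkQ_surjective y
    constructor
    · intro hy
      obtain ⟨β, rfl⟩ := (h₂.2.1 z).mp (by simpa using hy)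
      obtain ⟨k, rfl⟩ := h.2.2 β
      refine ⟨q (x - e k), ?_⟩
      rw [hsq]
      refine (Submodule.Quotient.eq S).mpr ((hS _).mpr ⟨-k, ?_, ?_⟩) <;> simp
    · rintro ⟨y, hy⟩
      obtain ⟨x, rfl⟩ := h₁.2.2 y
      rw [← hy, hsq]
      simp
  · intro c
    obtain ⟨z, rfl⟩ := h₂.2.2 c
    exact ⟨S.mkQ (0, z), by simp⟩

end Diagram

section Resolutions

variable {𝒢 : ∀ (N : Type u) [AddCommGroup N] [Module R N], Prop}
variable {M : Type u} [AddCommGroup M] [Module R M]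

theorem kernel_ses {A B C : Type u} [AddCommGroup A] [Module R A] [AddCommGroup B] [Module R B]
    [AddCommGroup C] [Module R C] {f : A →ₗ[R] B} {g : B →ₗ[R] C} (h : Function.Exact f g) :
    IsSES R (LinearMap.ker f).subtype
      (f.codRestrict (LinearMap.ker g) (fun x => h.apply_apply_eq_zero x)) := by
  refine ⟨Subtype.val_injective, ?_, ?_⟩
  · intro x
    constructor
    · intro hx
      exact ⟨⟨x, congrArg Subtype.val hx⟩, rfl⟩
    · rintro ⟨⟨y, hy⟩, rfl⟩
      exact Subtype.ext hy
  · rintro ⟨y, hy⟩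
    obtain ⟨x, rfl⟩ := (h y).mp hy
    exact ⟨x, rfl⟩

theorem left_mono {m n : ℕ} (hmn : m ≤ n) (h : HasLeftResolutionLE R 𝒢 M m) :
    HasLeftResolutionLE R 𝒢 M n := by
  obtain ⟨G, i1, i2, d, π, h1, h2, h3⟩ := h
  exact ⟨G, i1, i2, d, π, h1, fun i hi => h2 i (by omega), h3⟩

theorem left_zero (h : HasLeftResolutionLE R 𝒢 M 0) :
    ∃ (G : Type u) (_ : AddCommGroup G) (_ : Module R G), 𝒢 G ∧ Nonempty (G ≃ₗ[R] M) := by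
  obtain ⟨G, i1, i2, d, π, h1, h2, h3, h4, h5⟩ := h
  refine ⟨G 0, i1 0, i2 0, h1 0, ⟨LinearEquiv.ofBijective π ⟨?_, h3⟩⟩⟩
  refine (injective_iff_map_eq_zero _).mpr fun x hx => ?_
  obtain ⟨y, rfl⟩ := (h4 x).mp hx
  have := h2 (0 + 1) (by omega)
  rw [Subsingleton.elim y 0, map_zero]

theorem left_succ {n : ℕ} (h : HasLeftResolutionLE R 𝒢 M (n + 1)) :
    ∃ (K : Type u) (_ : AddCommGroup K) (_ : Module R K) (G : Type u) (_ : AddCommGroup G)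
      (_ : Module R G) (f : K →ₗ[R] G) (g : G →ₗ[R] M), 𝒢 G ∧ IsSES R f g ∧
      HasLeftResolutionLE R 𝒢 K n := by
  obtain ⟨G, i1, i2, d, π, h1, h2, h3, h4, h5⟩ := h
  refine ⟨LinearMap.ker π, inferInstance, inferInstance, G 0, i1 0, i2 0,
    (LinearMap.ker π).subtype, π, h1 0,
    ⟨Subtype.val_injective, LinearMap.exact_subtype_ker_map π, h3⟩, ?_⟩
  have hs := kernel_ses h4
  refine ⟨fun i => G (i + 1), fun i => i1 (i + 1), fun i => i2 (i + 1), fun i => d (i + 1),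
    (d 0).codRestrict (LinearMap.ker π) (fun x => h4.apply_apply_eq_zero x),
    fun i => h1 (i + 1), fun i hi => h2 (i + 1) (by omega), hs.2.2, ?_, fun i => h5 (i + 1)⟩
  intro x
  rw [← h5 0 x]
  exact Subtype.ext_iff

theorem left_of_mem (h0 : 𝒢 PUnit.{u+1}) (hM : 𝒢 M) : HasLeftResolutionLE R 𝒢 M 0 := by
  refine ⟨fun i => match i with | 0 => M | _ + 1 => PUnit.{u+1},
    fun i => match i with | 0 => inferInstanceAs (AddCommGroup M)
                          | _ + 1 => inferInstanceAs (AddCommGroup PUnit.{u+1}),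
    fun i => match i with | 0 => inferInstanceAs (Module R M)
                          | _ + 1 => inferInstanceAs (Module R PUnit.{u+1}),
    fun i => 0, LinearMap.id, ?_, ?_, Function.surjective_id, ?_, ?_⟩
  · rintro (_ | i)
    · exact hM
    · exact h0
  · rintro (_ | i) hi
    · omega
    · exact inferInstanceAs (Subsingleton PUnit.{u+1})
  · intro x
    constructor
    · rintro rfl
      exact ⟨PUnit.unit, rfl⟩
    · rintro ⟨y, rfl⟩
      rfl
  · intro i x
    exact ⟨fun _ => ⟨PUnit.unit, rfl⟩, fun _ => rfl⟩

theorem left_cons {n : ℕ} {K P : Type u} [AddCommGroup K] [Module R K] [AddCommGroup P]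
    [Module R P] {f : K →ₗ[R] P} {g : P →ₗ[R] M} (hs : IsSES R f g) (hP : 𝒢 P)
    (h : HasLeftResolutionLE R 𝒢 K n) : HasLeftResolutionLE R 𝒢 M (n + 1) := by
  obtain ⟨G, i1, i2, d, π, h1, h2, h3, h4, h5⟩ := h
  let G' : ℕ → Type u := fun i => match i with | 0 => P | i + 1 => G i
  let j1 : ∀ i, AddCommGroup (G' i) := fun i =>
    match i with | 0 => inferInstanceAs (AddCommGroup P) | i + 1 => i1 i
  let j2 : ∀ i, Module R (G' i) := fun i =>
    match i with | 0 => inferInstanceAs (Module R P) | i + 1 => i2 i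
  let d' : ∀ i, G' (i + 1) →ₗ[R] G' i := fun i =>
    match i with | 0 => f ∘ₗ π | i + 1 => d i
  refine ⟨G', j1, j2, d', g, ?_, ?_, hs.2.2, ?_, ?_⟩
  · rintro (_ | i)
    · exact hP
    · exact h1 i
  · rintro (_ | i) hi
    · omega
    · exact h2 i (by omega)
  · intro x
    constructor
    · intro hx
      obtain ⟨k, rfl⟩ := (hs.2.1 x).mp hx
      obtain ⟨y, rfl⟩ := h3 k
      exact ⟨y, rfl⟩
    · rintro ⟨y, rfl⟩
      exact hs.2.1.apply_apply_eq_zero (π y)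
  · rintro (_ | i)
    · intro x
      refine Iff.trans ?_ (h4 x)
      change f (π x) = 0 ↔ π x = 0
      exact map_eq_zero_iff f hs.1
    · exact h5 i

theorem right_zero (h : HasRightResolutionLE R 𝒢 M 0) :
    ∃ (G : Type u) (_ : AddCommGroup G) (_ : Module R G), 𝒢 G ∧ Nonempty (M ≃ₗ[R] G) := by
  obtain ⟨G, i1, i2, d, π, h1, h2, h3, h4, h5⟩ := h
  refine ⟨G 0, i1 0, i2 0, h1 0, ⟨LinearEquiv.ofBijective π ⟨h3, ?_⟩⟩⟩
  intro x
  have := h2 (0 + 1) (by omega)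
  exact (h4 x).mp (Subsingleton.elim _ _)

theorem right_succ {n : ℕ} (h : HasRightResolutionLE R 𝒢 M (n + 1)) :
    ∃ (G : Type u) (_ : AddCommGroup G) (_ : Module R G) (K : Type u) (_ : AddCommGroup K)
      (_ : Module R K) (f : M →ₗ[R] G) (g : G →ₗ[R] K), 𝒢 G ∧ IsSES R f g ∧
      HasRightResolutionLE R 𝒢 K n := by
  obtain ⟨G, i1, i2, d, π, h1, h2, h3, h4, h5⟩ := h
  have hs := kernel_ses (h5 0)
  refine ⟨G 0, i1 0, i2 0, LinearMap.ker (d (0 + 1)), inferInstance, inferInstance, π,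
    (d 0).codRestrict _ (fun x => (h5 0).apply_apply_eq_zero x), h1 0, ⟨h3, ?_, hs.2.2⟩, ?_⟩
  · intro x
    rw [← h4 x]
    exact Subtype.ext_iff
  · refine ⟨fun i => G (i + 1), fun i => i1 (i + 1), fun i => i2 (i + 1), fun i => d (i + 1),
      (LinearMap.ker (d (0 + 1))).subtype,
      fun i => h1 (i + 1), fun i hi => h2 (i + 1) (by omega), Subtype.val_injective,
      LinearMap.exact_subtype_ker_map _, fun i => h5 (i + 1)⟩

theorem right_of_mem (h0 : 𝒢 PUnit.{u+1}) (hM : 𝒢 M) : HasRightResolutionLE R 𝒢 M 0 := by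
  refine ⟨fun i => match i with | 0 => M | _ + 1 => PUnit.{u+1},
    fun i => match i with | 0 => inferInstanceAs (AddCommGroup M)
                          | _ + 1 => inferInstanceAs (AddCommGroup PUnit.{u+1}),
    fun i => match i with | 0 => inferInstanceAs (Module R M)
                          | _ + 1 => inferInstanceAs (Module R PUnit.{u+1}),
    fun i => 0, LinearMap.id, ?_, ?_, Function.injective_id, ?_, ?_⟩
  · rintro (_ | i)
    · exact hM
    · exact h0
  · rintro (_ | i) hi
    · omega
    · exact inferInstanceAs (Subsingleton PUnit.{u+1})
  · intro x
    exact ⟨fun _ => ⟨x, rfl⟩, fun _ => rfl⟩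
  · intro i x
    rcases i with _ | i
    · exact ⟨fun _ => ⟨(0 : M), rfl⟩, fun _ => rfl⟩
    · exact ⟨fun _ => ⟨PUnit.unit, rfl⟩, fun _ => rfl⟩

theorem right_cons {n : ℕ} {P K : Type u} [AddCommGroup K] [Module R K] [AddCommGroup P]
    [Module R P] {f : M →ₗ[R] P} {g : P →ₗ[R] K} (hs : IsSES R f g) (hP : 𝒢 P)
    (h : HasRightResolutionLE R 𝒢 K n) : HasRightResolutionLE R 𝒢 M (n + 1) := by
  obtain ⟨G, i1, i2, d, π, h1, h2, h3, h4, h5⟩ := h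
  let G' : ℕ → Type u := fun i => match i with | 0 => P | i + 1 => G i
  let j1 : ∀ i, AddCommGroup (G' i) := fun i =>
    match i with | 0 => inferInstanceAs (AddCommGroup P) | i + 1 => i1 i
  let j2 : ∀ i, Module R (G' i) := fun i =>
    match i with | 0 => inferInstanceAs (Module R P) | i + 1 => i2 i
  let d' : ∀ i, G' i →ₗ[R] G' (i + 1) := fun i =>
    match i with | 0 => π ∘ₗ g | i + 1 => d i
  refine ⟨G', j1, j2, d', f, ?_, ?_, hs.1, ?_, ?_⟩
  · rintro (_ | i)
    · exact hP
    · exact h1 i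
  · rintro (_ | i) hi
    · omega
    · exact h2 i (by omega)
  · intro x
    refine Iff.trans ?_ (hs.2.1 x)
    change π (g x) = 0 ↔ g x = 0
    exact map_eq_zero_iff π h3
  · rintro (_ | i)
    · intro x
      refine Iff.trans (h4 x) ?_
      constructor
      · rintro ⟨k, rfl⟩
        obtain ⟨y, rfl⟩ := hs.2.2 k
        exact ⟨y, rfl⟩
      · rintro ⟨y, rfl⟩
        exact ⟨g y, rfl⟩
    · exact h5 i

end Resolutions

section DimToRes

theorem left_of_pd (n : ℕ) : ∀ (M : Type u) [AddCommGroup M] [Module R M], PDLT R M (n + 1) →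
    HasLeftResolutionLE R (fun N _ _ => Module.Projective R N) M n := by
  induction n with
  | zero =>
    intro M _ _ h
    exact left_of_mem (𝒢 := fun N _ _ => Module.Projective R N) inferInstance
      ((pd_one_iff M).mp h)
  | succ n ih =>
    intro M _ _ h
    obtain ⟨K, _, _, P, _, _, f, g, hP, hs⟩ := exists_proj_cover (R := R) M
    refine left_cons (𝒢 := fun N _ _ => Module.Projective R N) hs hP (ih K ?_)
    exact pd_first hs (pd_mono (by omega) ((pd_one_iff P).mpr hP)) h

theorem right_of_id (n : ℕ) : ∀ (M : Type u) [AddCommGroup M] [Module R M], IDLT R M (n + 1) →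
    HasRightResolutionLE R (fun N _ _ => Module.Injective R N) M n := by
  induction n with
  | zero =>
    intro M _ _ h
    refine right_of_mem (𝒢 := fun N _ _ => Module.Injective R N) ⟨?_⟩ ((id_one_iff M).mp h)
    intros
    exact ⟨0, fun _ => rfl⟩
  | succ n ih =>
    intro M _ _ h
    obtain ⟨P, _, _, K, _, _, f, g, hP, hs⟩ := exists_inj_embedding (R := R) M
    refine right_cons (𝒢 := fun N _ _ => Module.Injective R N) hs hP (ih K ?_)
    exact id_third hs (id_mono (by omega) ((id_one_iff P).mpr hP)) h

theorem exists_of_sInf_le {S : Set ℕ} {n : ℕ} (h : sInf ((↑) '' S : Set ℕ∞) ≤ n) :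
    ∃ m ∈ S, m ≤ n := by
  rcases S.eq_empty_or_nonempty with rfl | hS
  · simp at h
  · obtain ⟨m, hm, he⟩ := csInf_mem (hS.image ((↑) : ℕ → ℕ∞))
    refine ⟨m, hm, ?_⟩
    rw [← he] at h
    exact_mod_cast h

end DimToRes

section Gorenstein

theorem complex_ext {P : ℤ → Type u} [∀ i, AddCommGroup (P i)] [∀ i, Module R (P i)]
    (d : ∀ i, P i →ₗ[R] P (i + 1)) (hP : ∀ i, Module.Projective R (P i))
    (hd : ∀ i, Function.Exact (d i) (d (i + 1))) (Q : Type u) [AddCommGroup Q] [Module R Q]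
    (hQ : ∀ i, Function.Exact (fun g : P (i + 1 + 1) →ₗ[R] Q => g.comp (d (i + 1)))
          (fun g : P (i + 1) →ₗ[R] Q => g.comp (d i))) (k : ℕ) :
    ∀ i, ExtVan R (k + 1) (LinearMap.ker (d i)) Q := by
  induction k with
  | zero =>
    intro i
    obtain ⟨j, rfl⟩ : ∃ j, i = j + 1 + 1 + 1 := ⟨i - 3, by ring⟩
    have hs := kernel_ses (hd (j + 1 + 1))
    have := hP (j + 1 + 1)
    refine ext_one_of_extend hs Q fun φ => ?_
    let c := (d (j + 1)).codRestrict (LinearMap.ker (d (j + 1 + 1)))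
      (fun x => (hd (j + 1)).apply_apply_eq_zero x)
    have hc : Function.Surjective c := (kernel_ses (hd (j + 1))).2.2
    have hz : (φ ∘ₗ c) ∘ₗ d j = 0 := by
      ext x
      have : c (d j x) = 0 := Subtype.ext ((hd j).apply_apply_eq_zero x)
      simp [this]
    obtain ⟨ψ, hψ⟩ := (hQ j (φ ∘ₗ c)).mp hz
    refine ⟨ψ, ?_⟩
    ext x
    obtain ⟨y, rfl⟩ := hc x
    exact LinearMap.congr_fun hψ y
  | succ k ih =>
    intro i
    obtain ⟨j, rfl⟩ : ∃ j, i = j + 1 := ⟨i - 1, by ring⟩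
    have := hP j
    exact ext_third (kernel_ses (hd j)) Q (k + 1) (ih j) (ext_proj _ _ _)

theorem gp_ext {G : Type u} [AddCommGroup G] [Module R G] (hG : GorensteinProjective R G)
    (Q : Type u) [AddCommGroup Q] [Module R Q] (hQ : Module.Projective R Q) (k : ℕ) :
    ExtVan R (k + 1) G Q := by
  obtain ⟨P, i1, i2, d, h1, h2, ⟨e⟩, h4⟩ := hG
  exact ext_congr e.symm Q _ (complex_ext d h1 h2 Q (h4 Q _ _ hQ) k 0)

theorem gp_cosyzygy {G : Type u} [AddCommGroup G] [Module R G] (hG : GorensteinProjective R G) :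
    ∃ (P : Type u) (_ : AddCommGroup P) (_ : Module R P) (G' : Type u) (_ : AddCommGroup G')
      (_ : Module R G') (f : G →ₗ[R] P) (g : P →ₗ[R] G'), Module.Projective R P ∧ IsSES R f g ∧
      GorensteinProjective R G' := by
  obtain ⟨P, i1, i2, d, h1, h2, ⟨e⟩, h4⟩ := hG
  have hs := kernel_ses (h2 0)
  refine ⟨P 0, i1 0, i2 0, LinearMap.ker (d (0 + 1)), inferInstance, inferInstance,
    (LinearMap.ker (d 0)).subtype ∘ₗ e.toLinearMap, _, h1 0,
    ⟨hs.1.comp e.injective, ?_, hs.2.2⟩, ?_⟩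
  · intro x
    rw [hs.2.1 x]
    constructor
    · rintro ⟨y, rfl⟩
      exact ⟨e.symm y, by simp⟩
    · rintro ⟨y, rfl⟩
      exact ⟨e y, rfl⟩
  · exact ⟨fun i => P (i + 1), fun i => i1 (i + 1), fun i => i2 (i + 1), fun i => d (i + 1),
      fun i => h1 (i + 1), fun i => h2 (i + 1), ⟨LinearEquiv.refl R _⟩,
      fun Q a b hQ i => h4 Q a b hQ (i + 1)⟩

/-- Finite-stage approximation of Gorenstein projectivity. -/
def GK (R : Type u) [Ring R] : ℕ → ∀ (X : Type u) [AddCommGroup X] [Module R X], Prop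
  | 0, X, _, _ => ∀ (Q : Type u) [AddCommGroup Q] [Module R Q], Module.Projective R Q →
      ExtVan R 1 X Q
  | k + 1, X, _, _ => (∀ (Q : Type u) [AddCommGroup Q] [Module R Q], Module.Projective R Q →
      ExtVan R 1 X Q) ∧
      ∃ (P : Type u) (_ : AddCommGroup P) (_ : Module R P) (X' : Type u) (_ : AddCommGroup X')
      (_ : Module R X') (f : X →ₗ[R] P) (g : P →ₗ[R] X'), Module.Projective R P ∧ IsSES R f g ∧
      GK R k X'

theorem gk_of_gp (k : ℕ) : ∀ (G : Type u) [AddCommGroup G] [Module R G],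
    GorensteinProjective R G → GK R k G := by
  induction k with
  | zero =>
    intro G _ _ hG Q _ _ hQ
    exact gp_ext hG Q hQ 0
  | succ k ih =>
    intro G _ _ hG
    refine ⟨fun Q _ _ hQ => gp_ext hG Q hQ 0, ?_⟩
    obtain ⟨P, _, _, G', _, _, f, g, h1, h2, h3⟩ := gp_cosyzygy hG
    exact ⟨P, _, _, G', _, _, f, g, h1, h2, ih G' h3⟩

theorem gk_extension (k : ℕ) : ∀ (A X B : Type u) [AddCommGroup A] [Module R A]
    [AddCommGroup X] [Module R X] [AddCommGroup B] [Module R B] (a : A →ₗ[R] X)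
    (b : X →ₗ[R] B), IsSES R a b → GK R k A → GK R k B → GK R k X := by
  induction k with
  | zero =>
    intro A X B _ _ _ _ _ _ a b hs hA hB Q _ _ hQ
    exact ext_middle hs Q 1 (hA Q hQ) (hB Q hQ)
  | succ k ih =>
    intro A X B _ _ _ _ _ _ a b hs hA hB
    refine ⟨fun Q _ _ hQ => ext_middle hs Q 1 (hA.1 Q hQ) (hB.1 Q hQ), ?_⟩
    obtain ⟨-, P, _, _, A', _, _, i, q, hP, hs1, hA'⟩ := hA
    obtain ⟨hB, P', _, _, B', _, _, i', q', hP', hs2, hB'⟩ := hB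
    obtain ⟨e, he⟩ := ext_extend hs P (hB P hP) i
    obtain ⟨X', _, _, j, r, s, t, h1, h2⟩ := three_by_three hs hs1 hs2 e he
    exact ⟨P × P', _, _, X', _, _, j, r, inferInstance, h1, ih A' X' B' s t h2 hA' hB'⟩

theorem gp_embed (n : ℕ) : ∀ (M : Type u) [AddCommGroup M] [Module R M],
    HasLeftResolutionLE R (fun N _ _ => GorensteinProjective R N) M n → ∀ k : ℕ,
    ∃ (H : Type u) (_ : AddCommGroup H) (_ : Module R H) (C : Type u) (_ : AddCommGroup C)
      (_ : Module R C) (f : M →ₗ[R] H) (g : H →ₗ[R] C), IsSES R f g ∧ PDLT R H (n + 1) ∧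
      GK R k C := by
  induction n with
  | zero =>
    intro M _ _ h k
    obtain ⟨G, _, _, hG, ⟨e⟩⟩ := left_zero h
    obtain ⟨P, _, _, G', _, _, f, g, h1, h2, h3⟩ := gp_cosyzygy hG
    refine ⟨P, _, _, G', _, _, f ∘ₗ e.symm.toLinearMap, g,
      ⟨h2.1.comp e.symm.injective, ?_, h2.2.2⟩, (pd_one_iff P).mpr h1, gk_of_gp k G' h3⟩
    intro x
    rw [h2.2.1 x]
    constructor
    · rintro ⟨y, rfl⟩
      exact ⟨e y, by simp⟩
    · rintro ⟨y, rfl⟩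
      exact ⟨e.symm y, rfl⟩
  | succ n ih =>
    intro M _ _ h k
    obtain ⟨K, _, _, G, _, _, i, π, hG, hs, hK⟩ := left_succ h
    obtain ⟨H, _, _, C, _, _, j, ρ, hs2, hH, hC⟩ := ih K hK (k + 1)
    obtain ⟨X, _, _, a, q, b, p, h1, h2⟩ := pushout_mono hs hs2
    obtain ⟨-, P, _, _, X', _, _, j', ρ', hP, h3, hX'⟩ :=
      gk_extension (k + 1) G X C a q h1 (gk_of_gp (k + 1) G hG) hC
    obtain ⟨H', _, _, c, m, q', h4, h5⟩ := third_iso h2 h3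
    exact ⟨H', _, _, X', _, _, m, q', h5,
      pd_third h4 hH (pd_mono (by omega) ((pd_one_iff P).mpr hP)), hX'⟩

theorem pd_of_injective {n : ℕ} (I : Type u) [AddCommGroup I] [Module R I]
    (hI : Module.Injective R I)
    (h : HasLeftResolutionLE R (fun N _ _ => GorensteinProjective R N) I n) :
    PDLT R I (n + 1) := by
  obtain ⟨H, _, _, C, _, _, f, g, hs, hH, -⟩ := gp_embed n I h 0
  obtain ⟨r, hr⟩ := hI.out f hs.1 LinearMap.id
  exact pd_of_retract f r (LinearMap.ext hr) hH

theorem gpd_ext (n : ℕ) (Q : Type u) [AddCommGroup Q] [Module R Q]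
    (hQ : Module.Projective R Q) : ∀ (M : Type u) [AddCommGroup M] [Module R M],
    HasLeftResolutionLE R (fun N _ _ => GorensteinProjective R N) M n → ∀ k : ℕ,
    ExtVan R (k + n + 1) M Q := by
  induction n with
  | zero =>
    intro M _ _ h k
    obtain ⟨G, _, _, hG, ⟨e⟩⟩ := left_zero h
    exact ext_congr e Q _ (gp_ext hG Q hQ k)
  | succ n ih =>
    intro M _ _ h k
    obtain ⟨K, _, _, G, _, _, i, π, hG, hs, hK⟩ := left_succ h
    exact ext_third hs Q _ (ih K hK k) (gp_ext hG Q hQ _)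

theorem id_of_projective {n : ℕ}
    (h : ∀ (X : Type u) [AddCommGroup X] [Module R X],
      HasLeftResolutionLE R (fun N _ _ => GorensteinProjective R N) X n)
    (Q : Type u) [AddCommGroup Q] [Module R Q] (hQ : Module.Projective R Q) :
    IDLT R Q (n + 1) := by
  let := HasExt.standard (ModuleCat.{u} R)
  refine (hasInjectiveDimensionLT_iff _ _).mpr fun i hi Y e => ?_
  obtain ⟨k, rfl⟩ : ∃ k, i = k + n + 1 := ⟨i - n - 1, by omega⟩
  exact gpd_ext n Q hQ Y (h Y) k e

theorem pd_of_right {n : ℕ}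
    (h : ∀ (X : Type u) [AddCommGroup X] [Module R X],
      HasLeftResolutionLE R (fun N _ _ => GorensteinProjective R N) X n) (m : ℕ) :
    ∀ (M : Type u) [AddCommGroup M] [Module R M],
    HasRightResolutionLE R (fun N _ _ => Module.Injective R N) M m → PDLT R M (n + 1) := by
  induction m with
  | zero =>
    intro M _ _ hM
    obtain ⟨G, _, _, hG, ⟨e⟩⟩ := right_zero hM
    exact pd_of_retract e.toLinearMap e.symm.toLinearMap (by ext; simp)
      (pd_of_injective G hG (h G))
  | succ m ih =>
    intro M _ _ hM
    obtain ⟨G, _, _, K, _, _, f, g, hG, hs, hK⟩ := right_succ hM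
    exact pd_first hs (pd_of_injective G hG (h G)) (pd_mono (by omega) (ih K hK))

theorem id_of_left {n : ℕ}
    (h : ∀ (Q : Type u) [AddCommGroup Q] [Module R Q], Module.Projective R Q →
      IDLT R Q (n + 1)) (m : ℕ) :
    ∀ (M : Type u) [AddCommGroup M] [Module R M], PDLT R M (m + 1) → IDLT R M (n + 1) := by
  induction m with
  | zero =>
    intro M _ _ hM
    exact h M ((pd_one_iff M).mp hM)
  | succ m ih =>
    intro M _ _ hM
    obtain ⟨K, _, _, P, _, _, f, g, hP, hs⟩ := exists_proj_cover (R := R) M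
    have hK : PDLT R K (m + 1) := pd_first hs (pd_mono (by omega) ((pd_one_iff P).mpr hP)) hM
    exact id_third hs (h P hP) (id_mono (by omega) (ih K hK))

end Gorenstein

section Flat

open TensorProduct

/-- The map `N ⊗_R R^(X) → N^(X)`. -/
noncomputable def freeTensorMap (N X : Type u) [AddCommGroup N] [Module Rᵐᵒᵖ N] :
    bTensor R N (X →₀ R) →+ (X →₀ N) :=
  QuotientAddGroup.lift (tensorRel R N (X →₀ R))
    (TensorProduct.liftAddHom (AddMonoidHom.mk'
      (fun n : N => (Finsupp.mapRange.addMonoidHom (AddMonoidHom.mk'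
        (fun r : R => MulOpposite.op r • n) (fun r s => by simp [add_smul])) :
          (X →₀ R) →+ (X →₀ N)))
      (fun n m => by ext; simp))
      (fun z n f => by
        ext a
        change MulOpposite.op (f a) • (z • n) = MulOpposite.op (z • f a) • n
        rw [smul_comm, MulOpposite.op_smul, smul_assoc])) <| by
    rw [tensorRel, AddSubgroup.closure_le]
    rintro x ⟨r, n, m, rfl⟩
    ext y
    simp [mul_smul]

theorem freeTensorMap_tmul (N X : Type u) [AddCommGroup N] [Module Rᵐᵒᵖ N] (n : N)
    (f : X →₀ R) (x : X) :
    freeTensorMap (R := R) N X (QuotientAddGroup.mk (n ⊗ₜ[ℤ] f)) x = MulOpposite.op (f x) • n :=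
  rfl

/-- The inverse map. -/
noncomputable def freeTensorInv (N X : Type u) [AddCommGroup N] [Module Rᵐᵒᵖ N] :
    (X →₀ N) →+ bTensor R N (X →₀ R) :=
  Finsupp.liftAddHom fun x => AddMonoidHom.mk'
    (fun n => (QuotientAddGroup.mk (n ⊗ₜ[ℤ] Finsupp.single x (1 : R)) : bTensor R N (X →₀ R)))
    (fun n m => by rw [TensorProduct.add_tmul]; rfl)

theorem bTensor_smul (N M : Type u) [AddCommGroup N] [Module Rᵐᵒᵖ N] [AddCommGroup M]
    [Module R M] (r : R) (n : N) (m : M) :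
    (QuotientAddGroup.mk ((MulOpposite.op r • n) ⊗ₜ[ℤ] m) : bTensor R N M) =
      QuotientAddGroup.mk (n ⊗ₜ[ℤ] (r • m)) := by
  rw [← sub_eq_zero, ← QuotientAddGroup.mk_sub, QuotientAddGroup.eq_zero_iff]
  exact AddSubgroup.subset_closure ⟨r, n, m, rfl⟩

theorem bTensor_hom_ext {N M A : Type u} [AddCommGroup N] [Module Rᵐᵒᵖ N] [AddCommGroup M]
    [Module R M] [AddCommGroup A] (f g : bTensor R N M →+ A)
    (h : ∀ n m, f (QuotientAddGroup.mk (n ⊗ₜ[ℤ] m)) = g (QuotientAddGroup.mk (n ⊗ₜ[ℤ] m))) :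
    f = g := by
  refine DFunLike.ext _ _ fun x => ?_
  obtain ⟨y, rfl⟩ := QuotientAddGroup.mk_surjective x
  induction y using TensorProduct.induction_on with
  | zero => rw [QuotientAddGroup.mk_zero, map_zero, map_zero]
  | tmul n m => exact h n m
  | add a b ha hb => rw [QuotientAddGroup.mk_add, map_add, map_add, ha, hb]

theorem freeTensor_left_inv (N X : Type u) [AddCommGroup N] [Module Rᵐᵒᵖ N] :
    (freeTensorInv (R := R) N X).comp (freeTensorMap N X) = AddMonoidHom.id _ := by
  refine bTensor_hom_ext _ _ fun n f => ?_
  induction f using Finsupp.induction_linear with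
  | zero => rw [TensorProduct.tmul_zero, QuotientAddGroup.mk_zero, map_zero, map_zero]
  | add f g hf hg => rw [TensorProduct.tmul_add, QuotientAddGroup.mk_add, map_add, map_add, hf, hg]
  | single x r =>
    have h1 : freeTensorMap (R := R) N X (QuotientAddGroup.mk (n ⊗ₜ[ℤ] Finsupp.single x r)) =
        Finsupp.single x (MulOpposite.op r • n) := by
      ext y
      rw [freeTensorMap_tmul]
      classical
      by_cases hxy : x = y <;> simp [Finsupp.single_apply, hxy]
    rw [AddMonoidHom.comp_apply, h1, freeTensorInv, Finsupp.liftAddHom_apply_single]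
    change (QuotientAddGroup.mk ((MulOpposite.op r • n) ⊗ₜ[ℤ] Finsupp.single x (1 : R)) :
      bTensor R N (X →₀ R)) = QuotientAddGroup.mk (n ⊗ₜ[ℤ] Finsupp.single x r)
    rw [bTensor_smul]
    simp

theorem free_flat (X : Type u) : ModFlat R (X →₀ R) := by
  intro N N' _ _ _ _ g hg
  have hinj : Function.Injective (freeTensorMap (R := R) N X) :=
    Function.LeftInverse.injective (g := freeTensorInv N X)
      (DFunLike.congr_fun (freeTensor_left_inv (R := R) N X))
  have hnat : (freeTensorMap (R := R) N' X).comp (tmapLeft R (X →₀ R) g) =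
      (Finsupp.mapRange.addMonoidHom g.toAddMonoidHom).comp (freeTensorMap N X) := by
    refine bTensor_hom_ext _ _ fun n f => ?_
    ext x
    change MulOpposite.op (f x) • g n = g (MulOpposite.op (f x) • n)
    rw [map_smul]
  have h2 : Function.Injective (Finsupp.mapRange.addMonoidHom g.toAddMonoidHom :
      (X →₀ N) →+ (X →₀ N')) :=
    Finsupp.mapRange_injective _ (map_zero g) hg
  refine Function.Injective.of_comp (f := freeTensorMap (R := R) N' X) ?_
  rw [← AddMonoidHom.coe_comp, hnat, AddMonoidHom.coe_comp]
  exact h2.comp hinj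

theorem projective_flat (P : Type u) [AddCommGroup P] [Module R P]
    (hP : Module.Projective R P) : ModFlat R P := by
  intro N N' _ _ _ _ g hg
  obtain ⟨s, hs⟩ := hP.out
  have hs' : ∀ x, Finsupp.linearCombination R id (s x) = x := hs
  have hinj : Function.Injective (tmapRight R N s) := by
    refine Function.LeftInverse.injective (g := tmapRight R N (Finsupp.linearCombination R id)) ?_
    refine DFunLike.congr_fun (bTensor_hom_ext
      ((tmapRight R N (Finsupp.linearCombination R id)).comp (tmapRight R N s))
      (AddMonoidHom.id _) fun n m => ?_)
    change (QuotientAddGroup.mk (n ⊗ₜ[ℤ] (Finsupp.linearCombination R id (s m))) : bTensor R N P)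
      = QuotientAddGroup.mk (n ⊗ₜ[ℤ] m)
    rw [hs']
  have hnat : (tmapRight R N' s).comp (tmapLeft R P g) =
      (tmapLeft R (P →₀ R) g).comp (tmapRight R N s) :=
    bTensor_hom_ext _ _ fun n m => rfl
  refine Function.Injective.of_comp (f := tmapRight R N' s) ?_
  rw [← AddMonoidHom.coe_comp, hnat, AddMonoidHom.coe_comp]
  exact (free_flat P N N' _ _ _ _ g hg).comp hinj

end Flat

end Helpers

/-- If `l.Ggldim(R) ≤ n` and `M` has finite injective dimension, then
`pd_R(M) ≤ n`, `id_R(M) ≤ n` and `fd_R(M) ≤ n`. -/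
theorem dims_le_of_iDim_finite (R : Type u) [Ring R] (n : ℕ) (h : GPgldim R ≤ n)
    (M : Type u) [AddCommGroup M] [Module R M] (hM : iDim R M ≠ ⊤) :
    pDim R M ≤ n ∧ iDim R M ≤ n ∧ fDim R M ≤ n := by
  have hG : ∀ (X : Type u) [AddCommGroup X] [Module R X],
      HasLeftResolutionLE R (fun N _ _ => GorensteinProjective R N) X n := by
    intro X _ _
    have hX' : gpDim R X ≤ GPgldim R := le_sSup ⟨X, _, _, rfl⟩
    have hX : gpDim R X ≤ n := hX'.trans h
    obtain ⟨m, hm, hmn⟩ := exists_of_sInf_le hX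
    exact left_mono hmn hm
  obtain ⟨m', hm'⟩ := ENat.ne_top_iff_exists.mp hM
  obtain ⟨m, hm, -⟩ := exists_of_sInf_le (n := m') (le_of_eq hm'.symm)
  have hpd : PDLT R M (n + 1) := pd_of_right hG m M hm
  have hid : IDLT R M (n + 1) := id_of_left (id_of_projective hG) n M hpd
  have hl := left_of_pd n M hpd
  refine ⟨sInf_le ⟨n, hl, rfl⟩, sInf_le ⟨n, right_of_id n M hid, rfl⟩, sInf_le ⟨n, ?_, rfl⟩⟩
  obtain ⟨G, i1, i2, d, π, h1, h2⟩ := hl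
  exact ⟨G, i1, i2, d, π, fun i => projective_flat (G i) (h1 i), h2⟩
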